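/- Let n ≥ 1 and let A and B be n×n integer matrices with B₍₀,₀₎ = A₍₀,₀₎ − 2 and B₍ᵢ,ⱼ₎ = A₍ᵢ,ⱼ₎ for all (i,j) ≠ (0,0). Suppose det(A) is odd and nonzero, det(B) is nonzero, and the cokernels ℤⁿ/A·ℤⁿ and ℤⁿ/B·ℤⁿ are isomorphic as abelian groups. Then the finite abelian group H = ℤⁿ/A·ℤⁿ can be generated by at most n − 1 elements, i.e., there exists a subset of H of cardinality at most n − 1 generating H. -/

import Mathlib

/-- A submodule of a free abelian group of finite rank that lies in no `p • M`, `p` prime, contains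
a vector on which some linear functional takes the value `1`. -/
theorem exists_dual_apply_eq_one {ι M : Type*} [Finite ι] [AddCommGroup M]
    (b : Module.Basis ι ℤ M) (N : Submodule ℤ M)
    (h : ∀ p : ℕ, p.Prime → ∃ x ∈ N, ∀ y : M, x ≠ (p : ℤ) • y) :
    ∃ v ∈ N, ∃ f : M →ₗ[ℤ] ℤ, f v = 1 := by
  obtain ⟨k, snf⟩ := N.smithNormalForm b
  have htop : Ideal.span (Set.range snf.a) = ⊤ := by
    obtain ⟨g, hg⟩ := (IsPrincipalIdealRing.principal (Ideal.span (Set.range snf.a))).principal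
    by_contra hne
    have hg1 : g.natAbs ≠ 1 := fun h1 => hne <| by
      rw [hg]
      exact Ideal.span_singleton_eq_top.2 (Int.isUnit_iff_natAbs_eq.2 h1)
    obtain ⟨p, hp, hpg⟩ := Nat.exists_prime_and_dvd hg1
    have hpa : ∀ i, (p : ℤ) ∣ snf.a i := fun i => by
      have hi : snf.a i ∈ Ideal.span (Set.range snf.a) := Ideal.subset_span ⟨i, rfl⟩
      rw [hg] at hi
      exact (Int.natCast_dvd.2 hpg).trans (Ideal.mem_span_singleton.1 hi)
    choose q hq using hpa
    obtain ⟨x, hxN, hx⟩ := h p hp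
    refine hx (∑ i, (snf.bN.repr ⟨x, hxN⟩ i * q i) • snf.bM (snf.f i)) ?_
    have hsum := congrArg (Subtype.val : N → M) (snf.bN.sum_repr ⟨x, hxN⟩)
    rw [AddSubmonoidClass.coe_finsetSum] at hsum
    rw [Finset.smul_sum]
    refine hsum.symm.trans ?_
    refine Finset.sum_congr rfl fun i _ => ?_
    rw [Submodule.coe_smul, snf.snf, hq, smul_smul, smul_smul]
    congr 1
    ring
  obtain ⟨c, hc⟩ := Ideal.mem_span_range_iff_exists_fun.1 ((Ideal.eq_top_iff_one _).1 htop)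
  refine ⟨∑ i, (snf.bN i : M), N.sum_mem fun i _ => (snf.bN i).2,
    snf.bM.constr ℤ (Function.extend snf.f c 0), ?_⟩
  rw [map_sum, ← hc]
  refine Finset.sum_congr rfl fun i _ => ?_
  rw [snf.snf, map_smul, Module.Basis.constr_basis, snf.f.injective.extend_apply, smul_eq_mul,
    mul_comm]

/-- If some functional takes the value `1` on `N`, then `M ⧸ N` needs fewer generators than the
rank of `M`. -/
theorem exists_finset_closure_quotient_eq_top {M : Type*} [AddCommGroup M] [Module.Free ℤ M]
    [Module.Finite ℤ M] (N : Submodule ℤ M) {v : M} (hv : v ∈ N) (f : M →ₗ[ℤ] ℤ) (hf : f v = 1) :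
    ∃ s : Finset (M ⧸ N), s.card ≤ Module.finrank ℤ M - 1 ∧
      AddSubgroup.closure (s : Set (M ⧸ N)) = ⊤ := by
  classical
  have hsurj : LinearMap.range f = ⊤ :=
    LinearMap.range_eq_top.2 fun z => ⟨z • v, by rw [map_smul, hf, smul_eq_mul, mul_one]⟩
  have hrank := (LinearMap.ker f).finrank_quotient_add_finrank
  rw [f.quotKerEquivRange.finrank_eq, hsurj, finrank_top, Module.finrank_self] at hrank
  let b := Module.finBasis ℤ (LinearMap.ker f)
  refine ⟨Finset.univ.image fun i => N.mkQ (b i), ?_, ?_⟩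
  · refine Finset.card_image_le.trans ?_
    rw [Finset.card_univ, Fintype.card_fin]
    omega
  · rw [eq_top_iff]
    intro x _
    obtain ⟨x, rfl⟩ := N.mkQ_surjective x
    have hker : x - f x • v ∈ LinearMap.ker f := by
      rw [LinearMap.mem_ker, map_sub, map_smul, hf, smul_eq_mul, mul_one, sub_self]
    have hx : N.mkQ x = N.mkQ (x - f x • v) := by
      rw [map_sub, map_smul, show N.mkQ v = 0 from (Submodule.Quotient.mk_eq_zero N).2 hv,
        smul_zero, sub_zero]
    have hsum := congrArg (N.mkQ ∘ₗ (LinearMap.ker f).subtype) (b.sum_repr ⟨_, hker⟩)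
    rw [map_sum] at hsum
    rw [hx]
    refine hsum ▸ AddSubgroup.sum_mem _ fun i _ => ?_
    rw [map_smul]
    exact AddSubgroup.zsmul_mem _ (AddSubgroup.subset_closure (by simp)) _

/-- A surjection `ℤⁿ → (ℤ/p)ⁿ` has kernel contained in `p ℤⁿ`. -/
theorem dvd_of_surjective_of_apply_eq_zero {ι : Type*} [Fintype ι] (p : ℕ) [Fact p.Prime]
    (g : (ι → ℤ) →+ (ι → ZMod p)) (hg : Function.Surjective g) {x : ι → ℤ} (hx : g x = 0) (i : ι) :
    (p : ℤ) ∣ x i := by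
  classical
  let G := Fintype.linearCombination (ZMod p) fun i => g (Pi.single i 1)
  have hG : ∀ y : ι → ℤ, G (fun i => (y i : ZMod p)) = g y := fun y => by
    conv_rhs => rw [pi_eq_sum_univ' y, map_sum]
    rw [Fintype.linearCombination_apply]
    refine Finset.sum_congr rfl fun i _ => ?_
    rw [map_zsmul, Int.cast_smul_eq_zsmul]
  have hinj : Function.Injective G := LinearMap.injective_iff_surjective.2 fun z =>
    let ⟨y, hy⟩ := hg z
    ⟨_, (hG y).trans hy⟩
  have h0 := hinj (((hG x).trans hx).trans (map_zero G).symm)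
  exact (ZMod.intCast_zmod_eq_zero_iff_dvd _ _).1 (congrFun h0 i)

/-- Whether all entries of a square integer matrix are divisible by a prime `p` depends only on the
cokernel of the matrix. -/
theorem dvd_entries_of_coker_addEquiv {ι : Type*} [Fintype ι] [DecidableEq ι]
    {A B : Matrix ι ι ℤ}
    (e : ((ι → ℤ) ⧸ LinearMap.range (Matrix.toLin' A)) ≃+
      ((ι → ℤ) ⧸ LinearMap.range (Matrix.toLin' B)))
    {p : ℕ} (hp : p.Prime) (hA : ∀ i j, (p : ℤ) ∣ A i j) (i j : ι) : (p : ℤ) ∣ B i j := by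
  have := Fact.mk hp
  let red : (ι → ℤ) →ₗ[ℤ] (ι → ZMod p) := (Int.castAddHom (ZMod p)).toIntLinearMap.compLeft ι
  have hred : LinearMap.range (Matrix.toLin' A) ≤ LinearMap.ker red := by
    rintro _ ⟨x, rfl⟩
    ext k
    refine (ZMod.intCast_zmod_eq_zero_iff_dvd _ _).2 ?_
    rw [Matrix.toLin'_apply]
    exact Finset.dvd_sum fun l _ => (hA k l).mul_right _
  let g : (ι → ℤ) →+ (ι → ZMod p) :=
    ((Submodule.liftQ _ red hred).toAddMonoidHom.comp e.symm.toAddMonoidHom).comp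
      (Submodule.mkQ (LinearMap.range (Matrix.toLin' B))).toAddMonoidHom
  have hg : Function.Surjective g := by
    have hlift : Function.Surjective (Submodule.liftQ _ red hred) := fun z =>
      ⟨Submodule.Quotient.mk fun k => (z k).cast, funext fun k => ZMod.intCast_zmod_cast (z k)⟩
    exact (hlift.comp e.symm.surjective).comp (Submodule.mkQ_surjective _)
  have hcol : g (B.col j) = 0 := by
    have hmem : Submodule.mkQ (LinearMap.range (Matrix.toLin' B)) (B.col j) = 0 :=
      (Submodule.Quotient.mk_eq_zero _).2
        ⟨Pi.single j 1, by rw [Matrix.toLin'_apply, Matrix.mulVec_single_one]⟩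
    change Submodule.liftQ _ red hred (e.symm (Submodule.mkQ _ (B.col j))) = 0
    rw [hmem, map_zero, map_zero]
  exact dvd_of_surjective_of_apply_eq_zero p g hg hcol i

/-- If `B` agrees with `A` except that its `(0,0)` entry is smaller by `2`,
`det A` is odd and nonzero, `det B` is nonzero, and the cokernels of `A` and
`B` are isomorphic, then the cokernel of `A` can be generated by at most
`n - 1` elements. -/
theorem coker_generated_by_lt_n {n : ℕ} (hn : 1 ≤ n)
    (A B : Matrix (Fin n) (Fin n) ℤ)
    (h00 : B ⟨0, hn⟩ ⟨0, hn⟩ = A ⟨0, hn⟩ ⟨0, hn⟩ - 2)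
    (hrest : ∀ i j : Fin n, (i, j) ≠ ((⟨0, hn⟩ : Fin n), (⟨0, hn⟩ : Fin n)) →
      B i j = A i j)
    (hodd : Odd A.det) (hA : A.det ≠ 0) (hB : B.det ≠ 0)
    (hiso : Nonempty
      (((Fin n → ℤ) ⧸ LinearMap.range (Matrix.toLin' A)) ≃+
        ((Fin n → ℤ) ⧸ LinearMap.range (Matrix.toLin' B)))) :
    ∃ s : Finset ((Fin n → ℤ) ⧸ LinearMap.range (Matrix.toLin' A)),
      s.card ≤ n - 1 ∧ AddSubgroup.closure (↑s : Set ((Fin n → ℤ) ⧸ LinearMap.range (Matrix.toLin' A))) = ⊤ := by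
  obtain ⟨e⟩ := hiso
  have hprime : ∀ p : ℕ, p.Prime → ∃ x ∈ LinearMap.range (Matrix.toLin' A),
      ∀ y : Fin n → ℤ, x ≠ (p : ℤ) • y := by
    intro p hp
    by_contra! hcon
    have hpA : ∀ i j, (p : ℤ) ∣ A i j := fun i j => by
      obtain ⟨y, hy⟩ := hcon (A.col j)
        ⟨Pi.single j 1, by rw [Matrix.toLin'_apply, Matrix.mulVec_single_one]⟩
      exact ⟨y i, congrFun hy i⟩
    have hp2 : (p : ℤ) ∣ 2 := by
      have hsub := dvd_sub (hpA ⟨0, hn⟩ ⟨0, hn⟩)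
        (dvd_entries_of_coker_addEquiv e hp hpA ⟨0, hn⟩ ⟨0, hn⟩)
      rwa [h00, sub_sub_cancel] at hsub
    obtain rfl : p = 2 := (Nat.prime_dvd_prime_iff_eq hp Nat.prime_two).1 (by exact_mod_cast hp2)
    have hdet : (2 : ℤ) ∣ A.det := by
      rw [Matrix.det_apply']
      exact Finset.dvd_sum fun σ _ => ((hpA (σ ⟨0, hn⟩) ⟨0, hn⟩).trans
        (Finset.dvd_prod_of_mem (fun i => A (σ i) i) (Finset.mem_univ _))).mul_left _
    exact (Int.not_even_iff_odd.2 hodd) (even_iff_two_dvd.2 hdet)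
  obtain ⟨v, hv, f, hf⟩ := exists_dual_apply_eq_one (Pi.basisFun ℤ (Fin n)) _ hprime
  simpa only [Module.finrank_fin_fun] using exists_finset_closure_quotient_eq_top _ hv f hf
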